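/- arXiv:2602.23879 — 3 statements merged into one kernel-verified Lean document; each statement's English description precedes it below -/
import Mathlib

section
/- Let Ω ⊆ ℝ^d be open and bounded with L^d(∂Ω) = 0. Then the number of grid points of Θ_n lying in Ω whose box is not contained in Ω is o(N(n)): for every ε > 0 there exists M such that for every multi-index n with min_i n_i ≥ M, #{ p ∈ Θ_n : p ∈ Ω and B_n(p) ⊄ Ω } ≤ ε·N(n). -/
open MeasureTheory

/-- The lattice `Θ_n` of points whose `i`-th coordinate is an integer multiple of `1/n_i`. -/
def thetaLattice (d : ℕ) (n : Fin d → ℕ) : Set (Fin d → ℝ) :=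
  { p | ∃ x : Fin d → ℤ, ∀ i, p i = (x i : ℝ) / (n i : ℝ) }

/-- The open box `B_n(y) = { x : n_i·|x_i − y_i| < 1 for all i }`. -/
def gridBox (d : ℕ) (n : Fin d → ℕ) (y : Fin d → ℝ) : Set (Fin d → ℝ) :=
  { x | ∀ i, (n i : ℝ) * |x i - y i| < 1 }

lemma gridBox_isPreconnected (d : ℕ) (n : Fin d → ℕ) (p : Fin d → ℝ) (hn : ∀ i, 0 < n i) :
    IsPreconnected (gridBox d n p) := by
  have h : gridBox d n p = Set.pi Set.univ fun i => Metric.ball (p i) (1 / (n i : ℝ)) := by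
    ext x
    simp only [gridBox, Set.mem_setOf_eq, Set.mem_pi, Set.mem_univ, true_imp_iff, Metric.mem_ball,
      Real.dist_eq]
    refine forall_congr' fun i => ?_
    have : (0 : ℝ) < n i := by exact_mod_cast hn i
    rw [lt_div_iff₀ this, mul_comm]
  rw [h]
  exact isPreconnected_univ_pi fun i => (convex_ball _ _).isPreconnected

lemma exists_frontier_gridBox (d : ℕ) (n : Fin d → ℕ) (p : Fin d → ℝ) (hn : ∀ i, 0 < n i)
    (Ω : Set (Fin d → ℝ)) (hΩ : IsOpen Ω) (hp : p ∈ Ω) (hb : ¬ gridBox d n p ⊆ Ω) :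
    ∃ q ∈ gridBox d n p, q ∈ frontier Ω := by
  by_contra! hcon
  obtain ⟨x, hx, hxΩ⟩ := Set.not_subset.1 hb
  have hfr : frontier Ω = closure Ω \ Ω := hΩ.frontier_eq
  have key : ∀ y ∈ gridBox d n p, y ∉ Ω → y ∉ closure Ω := fun y hy h1 h2 =>
    hcon y hy (by rw [hfr]; exact ⟨h2, h1⟩)
  obtain ⟨z, -, hz1, hz2⟩ := gridBox_isPreconnected d n p hn Ω (closure Ω)ᶜ hΩ
    isClosed_closure.isOpen_compl
    (fun y hy => by
      by_cases h : y ∈ Ω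
      · exact Or.inl h
      · exact Or.inr (key y hy h))
    ⟨p, by simp [gridBox], hp⟩ ⟨x, hx, key x hx hxΩ⟩
  exact hz2 (subset_closure hz1)

/-- Half-open cell based at `p`. -/
def halfCell (d : ℕ) (n : Fin d → ℕ) (p : Fin d → ℝ) : Set (Fin d → ℝ) :=
  Set.pi Set.univ fun i => Set.Ico (p i) (p i + 1 / (n i : ℝ))

lemma halfCell_inj (d : ℕ) (n : Fin d → ℕ) (hn : ∀ i, 0 < n i) {p q z : Fin d → ℝ}
    (hp : p ∈ thetaLattice d n) (hq : q ∈ thetaLattice d n)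
    (hzp : z ∈ halfCell d n p) (hzq : z ∈ halfCell d n q) : p = q := by
  obtain ⟨x, hx⟩ := hp
  obtain ⟨y, hy⟩ := hq
  funext i
  have h0 : (0 : ℝ) < n i := by exact_mod_cast hn i
  have h1 := hzp i (Set.mem_univ i)
  have h2 := hzq i (Set.mem_univ i)
  simp only [Set.mem_Ico, hx i, hy i, ← add_div, div_le_iff₀ h0, lt_div_iff₀ h0] at h1 h2
  have h3 : (x i : ℝ) < y i + 1 := by linarith
  have h4 : (y i : ℝ) < x i + 1 := by linarith
  have h5 : x i < y i + 1 := by exact_mod_cast h3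
  have h6 : y i < x i + 1 := by exact_mod_cast h4
  have : x i = y i := by omega
  rw [hx, hy, this]

lemma halfCell_volume (d : ℕ) (n : Fin d → ℕ) (p : Fin d → ℝ) :
    volume (halfCell d n p) = ENNReal.ofReal (∏ i, (1 / (n i : ℝ))) := by
  rw [halfCell, Real.volume_pi_Ico, ENNReal.ofReal_prod_of_nonneg]
  · simp
  · intro i _
    positivity

lemma finset_card_bound (d : ℕ) (n : Fin d → ℕ) (hn : ∀ i, 0 < n i) (K : Set (Fin d → ℝ))
    (ε : ℝ) (hε : 0 < ε) (hK : volume K ≤ ENNReal.ofReal ε) (F : Finset (Fin d → ℝ))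
    (hF : ∀ p ∈ F, p ∈ thetaLattice d n ∧ halfCell d n p ⊆ K) :
    (F.card : ℝ) ≤ ε * ∏ i, (n i : ℝ) := by
  have h1 : volume (⋃ p ∈ F, halfCell d n p) = ∑ p ∈ F, volume (halfCell d n p) := by
    apply measure_biUnion_finset
    · intro p hp q hq hpq
      refine Set.disjoint_left.2 fun z hz1 hz2 => hpq ?_
      exact halfCell_inj d n hn (hF p hp).1 (hF q hq).1 hz1 hz2
    · intro p _
      exact MeasurableSet.univ_pi fun i => measurableSet_Ico
  have h2 : volume (⋃ p ∈ F, halfCell d n p) ≤ ENNReal.ofReal ε :=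
    (measure_mono (Set.iUnion₂_subset fun p hp => (hF p hp).2)).trans hK
  rw [h1] at h2
  simp only [halfCell_volume, Finset.sum_const, nsmul_eq_mul] at h2
  rw [← ENNReal.ofReal_natCast, ← ENNReal.ofReal_mul (by positivity),
    ENNReal.ofReal_le_ofReal_iff hε.le, Finset.prod_div_distrib, Finset.prod_const_one,
    mul_one_div, div_le_iff₀] at h2
  · exact h2
  · exact Finset.prod_pos fun i _ => by exact_mod_cast hn i

/-- If `Ω ⊆ ℝ^d` is open and bounded with `L^d(∂Ω) = 0`, then the number of
lattice points of `Θ_n` lying in `Ω` whose box is not contained in `Ω` is `o(N(n))`: for every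
`ε > 0` there is `M` such that whenever `min_i n_i ≥ M`, this number is at most `ε·N(n)`. -/
theorem lattice_boundary_points_little_o (d : ℕ) (hd : 1 ≤ d) (Ω : Set (Fin d → ℝ))
    (hΩ : IsOpen Ω) (hbd : Bornology.IsBounded Ω) (hfr : volume (frontier Ω) = 0) :
    ∀ ε : ℝ, 0 < ε → ∃ M : ℕ, ∀ n : Fin d → ℕ, (∀ i, M ≤ n i) →
      { p ∈ thetaLattice d n | p ∈ Ω ∧ ¬ gridBox d n p ⊆ Ω }.Finite ∧
        (({ p ∈ thetaLattice d n | p ∈ Ω ∧ ¬ gridBox d n p ⊆ Ω }).ncard : ℝ) ≤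
          ε * ∏ i, (n i : ℝ) := by
  intro ε hε
  have hc : IsCompact (frontier Ω) :=
    Metric.isCompact_of_isClosed_isBounded isClosed_frontier
      (hbd.closure.subset frontier_subset_closure)
  have ht := tendsto_measure_cthickening_of_isCompact (μ := volume) hc
  rw [hfr] at ht
  have hev := ht.eventually_lt_const (ENNReal.ofReal_pos.2 hε)
  obtain ⟨r, hr, hball⟩ := Metric.eventually_nhds_iff.1 hev
  have hδ : volume (Metric.cthickening (r / 2) (frontier Ω)) < ENNReal.ofReal ε := by
    apply hball
    rw [Real.dist_eq, sub_zero, abs_of_pos (by positivity)]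
    linarith
  obtain ⟨M, hM⟩ := exists_nat_gt (4 / r)
  have hMpos : (0 : ℝ) < M := lt_trans (by positivity) hM
  refine ⟨M, fun n hn => ?_⟩
  have hM0 : 0 < M := by exact_mod_cast hMpos
  have hn0 : ∀ i, 0 < n i := fun i => hM0.trans_le (hn i)
  have hinv : ∀ i, 1 / (n i : ℝ) ≤ r / 4 := fun i => by
    have h1 : (M : ℝ) ≤ n i := by exact_mod_cast hn i
    have h0 : (0 : ℝ) < n i := by exact_mod_cast hn0 i
    rw [div_lt_iff₀ hr] at hM
    rw [div_le_div_iff₀ h0 (by norm_num)]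
    nlinarith
  have hcell : ∀ p ∈ {p ∈ thetaLattice d n | p ∈ Ω ∧ ¬ gridBox d n p ⊆ Ω},
      p ∈ thetaLattice d n ∧ halfCell d n p ⊆ Metric.cthickening (r / 2) (frontier Ω) := by
    rintro p ⟨hp, hpΩ, hpb⟩
    refine ⟨hp, fun z hz => ?_⟩
    obtain ⟨q, hq, hqf⟩ := exists_frontier_gridBox d n p hn0 Ω hΩ hpΩ hpb
    refine Metric.mem_cthickening_of_dist_le z q _ _ hqf ?_
    rw [dist_pi_le_iff (by positivity)]
    intro i
    have h0 : (0 : ℝ) < n i := by exact_mod_cast hn0 i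
    have h1 := hz i (Set.mem_univ i)
    have h2 : |q i - p i| < 1 / (n i : ℝ) := by
      rw [lt_div_iff₀ h0, mul_comm]
      exact hq i
    have h3 := hinv i
    rw [abs_lt] at h2
    rw [Real.dist_eq, abs_le]
    constructor <;> linarith [h1.1, h1.2, h2.1, h2.2]
  have hcard : ∀ F : Finset (Fin d → ℝ),
      (F : Set (Fin d → ℝ)) ⊆ {p ∈ thetaLattice d n | p ∈ Ω ∧ ¬ gridBox d n p ⊆ Ω} →
      (F.card : ℝ) ≤ ε * ∏ i, (n i : ℝ) := fun F hF =>
    finset_card_bound d n hn0 _ ε hε hδ.le F fun p hp => hcell p (hF hp)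
  have hfin : {p ∈ thetaLattice d n | p ∈ Ω ∧ ¬ gridBox d n p ⊆ Ω}.Finite := by
    by_contra hinf
    obtain ⟨k, hk⟩ := exists_nat_gt (ε * ∏ i, (n i : ℝ))
    obtain ⟨F, hF, hFk⟩ := Set.Infinite.exists_subset_card_eq hinf k
    have := hcard F hF
    rw [hFk] at this
    linarith
  refine ⟨hfin, ?_⟩
  rw [Set.ncard_eq_toFinset_card _ hfin]
  exact hcard _ (by simp)
end

section
/- Let Ω ⊆ ℝ^d be a nonempty open set with L^d(Ω) < ∞ and L^d(∂Ω) = 0. Then there exist c > 0 and M ∈ ℕ such that d_n^Ω ≥ c·N(n) for every multi-index n with min_i n_i ≥ M. -/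
open MeasureTheory

/-- The grid `Θ_{n,Ω}` of lattice points whose box is contained in `Ω`. -/
def thetaGrid (d : ℕ) (n : Fin d → ℕ) (Ω : Set (Fin d → ℝ)) : Set (Fin d → ℝ) :=
  { p ∈ thetaLattice d n | gridBox d n p ⊆ Ω }

theorem thetaGrid_finite (d : ℕ) (Ω : Set (Fin d → ℝ)) (hfin : volume Ω < ⊤)
    (n : Fin d → ℕ) (hn : ∀ i, 0 < n i) : (thetaGrid d n Ω).Finite := by
  have hn' : ∀ i, (0 : ℝ) < n i := fun i => by exact_mod_cast hn i
  let A : thetaGrid d n Ω → Set (Fin d → ℝ) := fun p =>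
    Set.pi Set.univ (fun i => Set.Ico (p.1 i) (p.1 i + 1 / n i))
  have hmeas : ∀ p, MeasurableSet (A p) := fun p =>
    MeasurableSet.univ_pi (fun i => measurableSet_Ico)
  have hvol : ∀ p, volume (A p) = ∏ i, ENNReal.ofReal (1 / n i) := by
    intro p
    simp only [A]
    rw [Real.volume_pi_Ico]
    simp
  have hdisj : Pairwise (Function.onFun Disjoint A) := by
    intro p q hpq
    rw [Function.onFun, Set.disjoint_left]
    intro z hzp hzq
    apply hpq
    obtain ⟨x, hx⟩ := p.2.1
    obtain ⟨y, hy⟩ := q.2.1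
    apply Subtype.ext
    funext i
    have h1 := hzp i trivial
    have h2 := hzq i trivial
    simp only [Set.mem_Ico] at h1 h2
    rw [hx i, ← add_div, div_le_iff₀ (hn' i), lt_div_iff₀ (hn' i)] at h1
    rw [hy i, ← add_div, div_le_iff₀ (hn' i), lt_div_iff₀ (hn' i)] at h2
    have e1 : (x i : ℝ) < y i + 1 := by linarith
    have e2 : (y i : ℝ) < x i + 1 := by linarith
    have e3 : x i < y i + 1 := by exact_mod_cast e1
    have e4 : y i < x i + 1 := by exact_mod_cast e2
    rw [hx i, hy i, show x i = y i by omega]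
  have hsub : (⋃ p, A p) ⊆ Ω := by
    apply Set.iUnion_subset
    intro p z hz
    apply p.2.2
    intro i
    have h1 := hz i trivial
    simp only [Set.mem_Ico] at h1
    rw [abs_of_nonneg (by linarith), mul_comm, ← lt_div_iff₀ (hn' i)]
    linarith
  have hpos : (0 : ENNReal) < ∏ i, ENNReal.ofReal (1 / n i) := by
    rw [pos_iff_ne_zero, Finset.prod_ne_zero_iff]
    intro i _
    have := hn' i
    rw [← pos_iff_ne_zero, ENNReal.ofReal_pos]
    positivity
  have h := Measure.finite_const_le_meas_of_disjoint_iUnion volume hpos hmeas hdisj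
    (ne_top_of_le_ne_top hfin.ne (measure_mono hsub))
  have h2 : {i | ∏ i, ENNReal.ofReal (1 / (n i : ℝ)) ≤ volume (A i)} = Set.univ := by
    ext p
    simp only [hvol, Set.mem_ofPred_eq, le_refl, Set.mem_univ]
  rw [h2] at h
  exact Set.finite_coe_iff.mp (Set.finite_univ_iff.mp h)

/-- If `Ω ⊆ ℝ^d` is a nonempty open set with `L^d(Ω) < ∞` and
`L^d(∂Ω) = 0`, then there are `c > 0` and `M` such that `d_n^Ω ≥ c·N(n)` for every
multi-index `n` with `min_i n_i ≥ M`. -/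
theorem thetaGrid_card_lower_bound (d : ℕ) (hd : 1 ≤ d) (Ω : Set (Fin d → ℝ))
    (hne : Ω.Nonempty) (hΩ : IsOpen Ω) (hfin : volume Ω < ⊤)
    (hfr : volume (frontier Ω) = 0) :
    ∃ c : ℝ, 0 < c ∧ ∃ M : ℕ, ∀ n : Fin d → ℕ, (∀ i, M ≤ n i) →
      c * ∏ i, (n i : ℝ) ≤ ((thetaGrid d n Ω).ncard : ℝ) := by
  obtain ⟨w, hw⟩ := hne
  obtain ⟨ε, hε, hball⟩ := Metric.isOpen_iff.mp hΩ w hw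
  refine ⟨(ε / 2) ^ d, by positivity, ⌈2 / ε⌉₊ + 1, fun n hn => ?_⟩
  have hn0 : ∀ i, 0 < n i := fun i => by have := hn i; omega
  have hn' : ∀ i, (0 : ℝ) < n i := fun i => by exact_mod_cast hn0 i
  have hbig : ∀ i, 2 ≤ n i * ε := fun i => by
    have h1 : 2 / ε ≤ ⌈2 / ε⌉₊ := Nat.le_ceil _
    have h2 : ((⌈2 / ε⌉₊ + 1 : ℕ) : ℝ) ≤ n i := by exact_mod_cast hn i
    push_cast at h2
    rw [← div_le_iff₀ hε]
    linarith
  let S : Finset (Fin d → ℤ) := Fintype.piFinset fun i =>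
    Finset.Icc ⌈n i * (w i - ε / 2)⌉ ⌊n i * (w i + ε / 2)⌋
  let f : (Fin d → ℤ) → (Fin d → ℝ) := fun x i => (x i : ℝ) / n i
  have hf : Function.Injective f := by
    intro x y hxy
    funext i
    have h := congrFun hxy i
    simp only [f] at h
    rw [div_left_inj' (hn' i).ne'] at h
    exact_mod_cast h
  have hsub : Set.image f (S : Set (Fin d → ℤ)) ⊆ thetaGrid d n Ω := by
    rintro _ ⟨x, hx, rfl⟩
    refine ⟨⟨x, fun i => rfl⟩, fun z hz => hball ?_⟩
    rw [Metric.mem_ball, dist_pi_lt_iff hε]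
    intro i
    have hxi := Fintype.mem_piFinset.mp (Finset.mem_coe.mp hx) i
    rw [Finset.mem_Icc, Int.ceil_le, Int.le_floor] at hxi
    have hzi := hz i
    simp only [f] at hzi
    rw [mul_comm, ← lt_div_iff₀ (hn' i), abs_lt] at hzi
    have h1 : w i - ε / 2 ≤ x i / n i := by
      rw [le_div_iff₀ (hn' i)]; linarith
    have h2 : x i / n i ≤ w i + ε / 2 := by
      rw [div_le_iff₀ (hn' i)]; linarith
    have h3 : 1 / (n i : ℝ) ≤ ε / 2 := by
      rw [div_le_iff₀ (hn' i)]; linarith [hbig i]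
    rw [Real.dist_eq, abs_lt]
    constructor <;> linarith
  have hcard := Set.ncard_le_ncard hsub (thetaGrid_finite d Ω hfin n hn0)
  rw [Set.ncard_image_of_injective _ hf, Set.ncard_coe_finset] at hcard
  have hS : (ε / 2) ^ d * ∏ i, (n i : ℝ) ≤ (S.card : ℝ) := by
    simp only [S, Fintype.card_piFinset, Int.card_Icc]
    push_cast
    have : (ε / 2) ^ d * ∏ i, (n i : ℝ) = ∏ i, (ε / 2 * n i) := by
      rw [Finset.prod_mul_distrib, Finset.prod_const, Finset.card_univ, Fintype.card_fin]
    rw [this]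
    apply Finset.prod_le_prod
    · intro i _
      have := hn' i
      positivity
    · intro i _
      set a := (n i : ℝ) * (w i - ε / 2) with ha
      set b := (n i : ℝ) * (w i + ε / 2) with hb
      have h1 := Int.ceil_lt_add_one a
      have h2 := Int.lt_floor_add_one b
      have h3 : ((⌊b⌋ + 1 - ⌈a⌉ : ℤ) : ℝ) ≤ (((⌊b⌋ + 1 - ⌈a⌉).toNat : ℤ) : ℝ) := by
        exact_mod_cast Int.self_le_toNat _
      push_cast at h3
      have h4 : b - a = n i * ε := by rw [ha, hb]; ring
      have := hbig i
      linarith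
  exact hS.trans (by exact_mod_cast hcard)
end

section
/- Let Ω ⊆ ℝ^d be open with 0 < L^d(Ω) < ∞ and let Ω' ⊆ Ω be open with L^d(Ω') > 0. Then for every measurable function h : Ω×[−π,π]^d → ℂ, p_{m,Ω'}( (L^d(Ω)/L^d(Ω'))·(h restricted to Ω'×[−π,π]^d) ) ≤ (L^d(Ω)/L^d(Ω'))·p_{m,Ω}(h). -/
open MeasureTheory ENNReal

/-- The frequency cube `[−π, π]^d ⊆ ℝ^d`. -/
def thetaCube (d : ℕ) : Set (Fin d → ℝ) :=
  Set.pi Set.univ fun _ => Set.Icc (-Real.pi) Real.pi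

/-- The quantity
`p_{m,D}(h) = inf { L^{2d}(E)/((2π)^d·L^d(D)) + esssup_{(D×[−π,π]^d)\E} |h| }`,
the infimum being taken over all measurable subsets `E` of `D×[−π,π]^d`. -/
noncomputable def pm (d : ℕ) (D : Set (Fin d → ℝ))
    (h : (Fin d → ℝ) × (Fin d → ℝ) → ℂ) : ℝ≥0∞ :=
  ⨅ (E : Set ((Fin d → ℝ) × (Fin d → ℝ))) (_ : MeasurableSet E) (_ : E ⊆ D ×ˢ thetaCube d),
    volume E / (ENNReal.ofReal ((2 * Real.pi) ^ d) * volume D) +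
      essSup (fun z => (‖h z‖₊ : ℝ≥0∞)) (volume.restrict ((D ×ˢ thetaCube d) \ E))

/-- Let `Ω ⊆ ℝ^d` be open with `0 < L^d(Ω) < ∞` and let `Ω' ⊆ Ω` be open
with `L^d(Ω') > 0`. Then for every measurable `h` on `Ω×[−π,π]^d`,
`p_{m,Ω'}((L^d(Ω)/L^d(Ω'))·(h|_{Ω'×[−π,π]^d})) ≤ (L^d(Ω)/L^d(Ω'))·p_{m,Ω}(h)`. -/
theorem pm_subdomain_scaled_le (d : ℕ) (Ω Ω' : Set (Fin d → ℝ))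
    (hΩopen : IsOpen Ω) (hΩpos : 0 < volume Ω) (hΩfin : volume Ω < ⊤)
    (hΩ'open : IsOpen Ω') (hsub : Ω' ⊆ Ω) (hΩ'pos : 0 < volume Ω')
    (h : (Fin d → ℝ) × (Fin d → ℝ) → ℂ) (hmeas : Measurable h) :
    pm d Ω' (fun z => (((volume Ω).toReal / (volume Ω').toReal : ℝ) : ℂ) * h z) ≤
      ENNReal.ofReal ((volume Ω).toReal / (volume Ω').toReal) * pm d Ω h := by
  have hΩ'fin : volume Ω' < ⊤ := lt_of_le_of_lt (measure_mono hsub) hΩfin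
  have hp : 0 < (volume Ω).toReal := ENNReal.toReal_pos hΩpos.ne' hΩfin.ne
  have hp' : 0 < (volume Ω').toReal := ENNReal.toReal_pos hΩ'pos.ne' hΩ'fin.ne
  have hc : 0 < (volume Ω).toReal / (volume Ω').toReal := div_pos hp hp'
  have ha : ENNReal.ofReal ((volume Ω).toReal / (volume Ω').toReal) = volume Ω / volume Ω' := by
    rw [ENNReal.ofReal_div_of_pos hp', ENNReal.ofReal_toReal hΩfin.ne,
      ENNReal.ofReal_toReal hΩ'fin.ne]
  have ha0 : ENNReal.ofReal ((volume Ω).toReal / (volume Ω').toReal) ≠ 0 := by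
    simpa using hc
  have hcube : MeasurableSet (thetaCube d) :=
    MeasurableSet.univ_pi fun _ => measurableSet_Icc
  unfold pm
  simp only [ENNReal.mul_iInf_of_ne ha0 ENNReal.ofReal_ne_top]
  refine le_iInf fun E => le_iInf fun hE => le_iInf fun _ => ?_
  refine (iInf_le _ (E ∩ (Ω' ×ˢ thetaCube d))).trans ?_
  refine (iInf_le _ (hE.inter (hΩ'open.measurableSet.prod hcube))).trans ?_
  refine (iInf_le _ Set.inter_subset_right).trans ?_
  rw [mul_add]
  refine add_le_add ?_ ?_
  · rw [ha]
    have hk0 : ENNReal.ofReal ((2 * Real.pi) ^ d) ≠ 0 := by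
      have : 0 < (2 * Real.pi) ^ d := by positivity
      simpa using this
    have e : volume Ω / volume Ω' * (volume E / (ENNReal.ofReal ((2 * Real.pi) ^ d) * volume Ω))
        = volume E / (ENNReal.ofReal ((2 * Real.pi) ^ d) * volume Ω') := by
      simp only [div_eq_mul_inv]
      rw [ENNReal.mul_inv (Or.inl hk0) (Or.inl ENNReal.ofReal_ne_top),
        ENNReal.mul_inv (Or.inl hk0) (Or.inl ENNReal.ofReal_ne_top)]
      calc _ = (volume Ω * (volume Ω)⁻¹) * (volume E *
            ((ENNReal.ofReal ((2 * Real.pi) ^ d))⁻¹ * (volume Ω')⁻¹)) := by ring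
        _ = _ := by rw [ENNReal.mul_inv_cancel hΩpos.ne' hΩfin.ne, one_mul]
    rw [e]
    exact ENNReal.div_le_div_right (measure_mono Set.inter_subset_left) _
  · rw [← ENNReal.essSup_const_mul]
    have hf : (fun z => (‖(((volume Ω).toReal / (volume Ω').toReal : ℝ) : ℂ) * h z‖₊ : ℝ≥0∞))
        = fun z => ENNReal.ofReal ((volume Ω).toReal / (volume Ω').toReal) *
          (‖h z‖₊ : ℝ≥0∞) := by
      funext z
      rw [nnnorm_mul, ENNReal.coe_mul]
      congr 1
      rw [← enorm_eq_nnnorm, ← ofReal_norm_eq_enorm, Complex.norm_real,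
        Real.norm_of_nonneg hc.le]
    rw [hf]
    refine essSup_mono_measure (Measure.absolutelyContinuous_of_le
      (Measure.restrict_mono ?_ le_rfl))
    rintro z ⟨hz, hzE⟩
    exact ⟨⟨hsub hz.1, hz.2⟩, fun hzE' => hzE ⟨hzE', hz⟩⟩
end
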